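/- Let l ≥ 2, let ξ ∈ V_l ⊖ S_l and let ξ' ∈ V_l. Then for all integers m, n, m', n' ≥ 0: ⟨ξ_{m,n}, ξ'_{m',n'}⟩ = (L−1)^{m+n}·⟨ξ, ξ'⟩ if (m,n) = (m',n'), and ⟨ξ_{m,n}, ξ'_{m',n'}⟩ = 0 otherwise, where ⟨·,·⟩ is the inner product of ℓ²(W). -/

import Mathlib

noncomputable section

open scoped ComplexInnerProductSpace

namespace UCoxMasa

/-- The universal Coxeter matrix on `Fin L`: all off-diagonal entries are `0` (representing ∞). -/
def Mat (L : ℕ) : CoxeterMatrix (Fin L) where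
  M := fun i j => if i = j then 1 else 0
  isSymm := by
    ext i j
    by_cases h : i = j <;> simp [Matrix.transpose, h, eq_comm]
  diagonal := fun i => by simp
  off_diagonal := fun i j h => by simp [h]

/-- The universal Coxeter group on `L` generators: free product of `L` copies of `ℤ/2ℤ`. -/
abbrev W (L : ℕ) : Type := (Mat L).Group

/-- The distinguished Coxeter system of `W L`. -/
def cs (L : ℕ) : CoxeterSystem (Mat L) (W L) := CoxeterMatrix.toCoxeterSystem (Mat L)

/-- The simple reflection associated to `i : Fin L`. -/
def σ {L : ℕ} (i : Fin L) : W L := (cs L).simple i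

/-- Word length on `W L` with respect to the generating set of simple reflections. -/
def len {L : ℕ} (w : W L) : ℕ := (cs L).length w

/-- The Hilbert space `ℓ²(W)`. -/
abbrev H (L : ℕ) : Type := lp (fun _ : W L => ℂ) 2

/-- The standard orthonormal basis vector `δ_w` of `ℓ²(W)`. -/
def δ {L : ℕ} (w : W L) : H L :=
  letI := Classical.decEq (W L)
  lp.single 2 w 1

/-- `V l`: the linear span of `{δ_w : ℓ(w) = l}`. -/
def V (L : ℕ) (l : ℕ) : Submodule ℂ (H L) :=
  Submodule.span ℂ {x : H L | ∃ w : W L, len w = l ∧ x = δ w}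

/-- `S_l`: the linear span of `q_l(h V_{l-1}) ∪ q_l(R_h V_{l-1})`,
given the projections `Q`, the operator `h` and the right operator `Rh`. -/
def Sl (L : ℕ) (Q : ℕ → (H L →L[ℂ] H L)) (h Rh : H L →L[ℂ] H L) (l : ℕ) :
    Submodule ℂ (H L) :=
  Submodule.span ℂ
    ({x : H L | ∃ y ∈ V L (l - 1), x = Q l (h y)} ∪
      {x : H L | ∃ y ∈ V L (l - 1), x = Q l (Rh y)})

end UCoxMasa


namespace UCoxMasa

variable {L : ℕ}

section NormalForm

/-- Words without two equal consecutive letters. -/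
abbrev ReducedWord (L : ℕ) : Type := {ω : List (Fin L) // ω.IsChain (· ≠ ·)}

/-- Left multiplication of a reduced word by a letter, followed by reduction. -/
def push (s : Fin L) : ReducedWord L → ReducedWord L
  | ⟨[], _⟩ => ⟨[s], by simp⟩
  | ⟨a :: t, h⟩ =>
    if hs : s = a then ⟨t, h.tail⟩ else ⟨s :: a :: t, List.isChain_cons_cons.2 ⟨hs, h⟩⟩

theorem push_push (s : Fin L) (x : ReducedWord L) : push s (push s x) = x := by
  obtain ⟨_ | ⟨a, t⟩, h⟩ := x
  · simp [push]
  · by_cases hs : s = a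
    · subst hs
      rcases t with _ | ⟨b, r⟩
      · simp [push]
      · have hb : s ≠ b := (List.isChain_cons_cons.1 h).1
        simp [push, hb]
    · simp [push, hs]

theorem wordProd_push (s : Fin L) (x : ReducedWord L) :
    (cs L).wordProd (push s x).1 = σ s * (cs L).wordProd x.1 := by
  obtain ⟨_ | ⟨a, t⟩, h⟩ := x
  · simp [push, σ]
  · by_cases hs : s = a
    · subst hs
      simp [push, σ, CoxeterSystem.wordProd_cons]
    · simp [push, hs, σ, CoxeterSystem.wordProd_cons]

theorem length_push_le (s : Fin L) (x : ReducedWord L) :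
    (push s x).1.length ≤ x.1.length + 1 := by
  obtain ⟨_ | ⟨a, t⟩, h⟩ := x
  · simp [push]
  · by_cases hs : s = a
    · subst hs
      simp [push]
      omega
    · simp [push, hs]

theorem head?_eq_of_length_push_lt {s : Fin L} {x : ReducedWord L}
    (hx : (push s x).1.length < x.1.length) : x.1.head? = some s := by
  obtain ⟨_ | ⟨a, t⟩, h⟩ := x
  · simp [push] at hx
  · by_cases hs : s = a
    · simp [hs]
    · simp [push, hs] at hx

/-- `push` as an element of the monoid of self-maps of the set of reduced words. -/
def pushEnd (s : Fin L) : Function.End (ReducedWord L) := push s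

theorem pushEnd_isLiftable : (Mat L).IsLiftable (pushEnd (L := L)) := by
  intro i j
  by_cases hij : i = j
  · subst hij
    rw [CoxeterMatrix.diagonal, pow_one]
    funext x
    exact push_push i x
  · have : (Mat L) i j = 0 := if_neg hij
    rw [this, pow_zero]

/-- The normal form of an element of `W L`. -/
def normalForm (w : W L) : ReducedWord L :=
  (cs L).lift ⟨_, pushEnd_isLiftable⟩ w ⟨[], by simp⟩

theorem normalForm_one : normalForm (1 : W L) = ⟨[], by simp⟩ := by
  rw [normalForm, map_one]
  rfl

theorem normalForm_simple_mul (s : Fin L) (w : W L) :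
    normalForm (σ s * w) = push s (normalForm w) := by
  have := (cs L).lift_apply_simple pushEnd_isLiftable s
  simp only [normalForm, map_mul, σ, this]
  rfl

theorem wordProd_normalForm (w : W L) : (cs L).wordProd (normalForm w).1 = w := by
  induction w using (cs L).simple_induction_left with
  | one => simp [normalForm_one]
  | mul_simple_left w i ih =>
    change (cs L).wordProd (normalForm (σ i * w)).1 = σ i * w
    rw [normalForm_simple_mul, wordProd_push, ih]

theorem length_normalForm (w : W L) : (normalForm w).1.length = len w := by
  apply le_antisymm
  · obtain ⟨ω, hω, rfl⟩ := (cs L).exists_isReduced w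
    rw [len, hω.eq]
    clear hω
    induction ω with
    | nil => simp [normalForm_one]
    | cons s ω ih =>
      rw [CoxeterSystem.wordProd_cons]
      change (normalForm (σ s * _)).1.length ≤ _
      rw [normalForm_simple_mul]
      exact (length_push_le _ _).trans (by simpa using ih)
  · have := (cs L).length_wordProd_le (normalForm w).1
    rwa [wordProd_normalForm] at this

theorem leftDescent_unique {w : W L} {s t : Fin L} (hs : len (σ s * w) < len w)
    (ht : len (σ t * w) < len w) : s = t := by
  rw [← length_normalForm, ← length_normalForm, normalForm_simple_mul] at hs ht
  exact Option.some_injective _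
    ((head?_eq_of_length_push_lt hs).symm.trans (head?_eq_of_length_push_lt ht))

end NormalForm

theorem σ_mul_self (s : Fin L) : (σ s : W L) * σ s = 1 := (cs L).simple_mul_simple_self s

theorem σ_inv (s : Fin L) : (σ s : W L)⁻¹ = σ s := (cs L).inv_simple s

theorem len_inv (w : W L) : len w⁻¹ = len w := (cs L).length_inv w

theorem len_mul_σ (w : W L) (s : Fin L) : len (w * σ s) = len (σ s * w⁻¹) := by
  rw [← len_inv, mul_inv_rev, σ_inv]

theorem len_σ_mul (s : Fin L) (w : W L) :
    len (σ s * w) = len w + 1 ∨ len (σ s * w) + 1 = len w := (cs L).length_simple_mul w s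

theorem len_mul_σ' (s : Fin L) (w : W L) :
    len (w * σ s) = len w + 1 ∨ len (w * σ s) + 1 = len w := (cs L).length_mul_simple w s

theorem len_eq_zero {w : W L} : len w = 0 ↔ w = 1 := (cs L).length_eq_zero_iff

theorem rightDescent_unique {w : W L} {s t : Fin L} (hs : len (w * σ s) < len w)
    (ht : len (w * σ t) < len w) : s = t := by
  rw [len_mul_σ, ← len_inv w] at hs ht
  exact leftDescent_unique hs ht

theorem existsUnique_leftDescent {w : W L} (hw : len w ≠ 0) :
    ∃! s : Fin L, len (σ s * w) < len w := by
  obtain ⟨s, hs⟩ := (cs L).exists_leftDescent_of_ne_one (mt len_eq_zero.2 hw)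
  exact ⟨s, hs, fun t ht => leftDescent_unique ht hs⟩

theorem existsUnique_rightDescent {w : W L} (hw : len w ≠ 0) :
    ∃! s : Fin L, len (w * σ s) < len w := by
  obtain ⟨s, hs⟩ := (cs L).exists_rightDescent_of_ne_one (mt len_eq_zero.2 hw)
  exact ⟨s, hs, fun t ht => rightDescent_unique ht hs⟩

/-- Removing a first letter commutes with appending a last letter on words of length at
least two. -/
theorem descent_ascent_comm {w : W L} (hw : 2 ≤ len w) (s t : Fin L) :
    (len w < len (w * σ t) ∧ len (σ s * (w * σ t)) < len (w * σ t)) ↔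
      (len (σ s * w) < len w ∧ len (σ s * w) < len (σ s * w * σ t)) := by
  have h1 := len_σ_mul s w
  have h2 := len_mul_σ' t w
  have h3 := len_σ_mul s (w * σ t)
  have h4 := len_mul_σ' t (σ s * w)
  rw [mul_assoc] at h4 ⊢
  constructor
  · rintro ⟨h5, h6⟩
    obtain ⟨r, hr, -⟩ := existsUnique_leftDescent (w := w) (by omega)
    have h7 := len_mul_σ' t (σ r * w)
    rw [mul_assoc] at h7
    have : s = r := leftDescent_unique h6 (by omega)
    subst this
    omega
  · rintro ⟨h5, h6⟩
    by_contra hcon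
    obtain ⟨r, hr, -⟩ := existsUnique_rightDescent (w := σ s * w) (by omega)
    have h7 := len_σ_mul s (σ s * w * σ r)
    have h8 : σ s * (σ s * w * σ r) = w * σ r := by
      rw [mul_assoc, ← mul_assoc, σ_mul_self, one_mul]
    rw [h8] at h7
    have : t = r := rightDescent_unique (w := w) (by omega) (by omega)
    subst this
    rw [mul_assoc] at hr
    omega

theorem descent_ascent_comm' {w : W L} (hw : 2 ≤ len w) (s t : Fin L) :
    (len w < len (σ s * w) ∧ len (σ s * w * σ t) < len (σ s * w)) ↔
      (len (w * σ t) < len w ∧ len (w * σ t) < len (σ s * (w * σ t))) := by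
  have key := descent_ascent_comm (w := w⁻¹) (by rwa [len_inv]) t s
  have e1 : w⁻¹ * σ s = (σ s * w)⁻¹ := by rw [mul_inv_rev, σ_inv]
  have e2 : σ t * w⁻¹ = (w * σ t)⁻¹ := by rw [mul_inv_rev, σ_inv]
  have e3 : σ t * (σ s * w)⁻¹ = (σ s * w * σ t)⁻¹ := by
    rw [mul_inv_rev _ (σ t), σ_inv]
  have e4 : (w * σ t)⁻¹ * σ s = (σ s * (w * σ t))⁻¹ := by
    rw [mul_inv_rev _ (w * σ t), σ_inv]
  rw [e1, e2, e3, e4] at key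
  simpa only [len_inv] using key

/-- A left action of `W L` on itself for which every simple reflection changes the length by one
and every nontrivial element has exactly one descent. -/
structure LengthAction (α : W L → W L → W L) : Prop where
  one_act : ∀ w, α 1 w = w
  mul_act : ∀ u v w, α (u * v) w = α u (α v w)
  len_simple : ∀ s w, len (α (σ s) w) = len w + 1 ∨ len (α (σ s) w) + 1 = len w
  descent : ∀ w, len w ≠ 0 → ∃! s, len (α (σ s) w) < len w

theorem LengthAction.simple_simple {α : W L → W L → W L} (hα : LengthAction α) (s : Fin L)
    (w : W L) : α (σ s) (α (σ s) w) = w := by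
  rw [← hα.mul_act, σ_mul_self, hα.one_act]

/-- Left multiplication. -/
def leftAct (u w : W L) : W L := u * w

/-- Right multiplication by the inverse. -/
def rightAct (u w : W L) : W L := w * u⁻¹

theorem rightAct_σ (s : Fin L) (w : W L) : rightAct (σ s) w = w * σ s := by
  rw [rightAct, σ_inv]

theorem lengthAction_leftAct : LengthAction (leftAct (L := L)) where
  one_act := one_mul
  mul_act := mul_assoc
  len_simple := len_σ_mul
  descent _ := existsUnique_leftDescent

theorem lengthAction_rightAct : LengthAction (rightAct (L := L)) where
  one_act w := by simp [rightAct]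
  mul_act u v w := by simp [rightAct, mul_assoc]
  len_simple s w := by
    rw [rightAct_σ]
    exact len_mul_σ' s w
  descent w hw := by
    simp only [rightAct_σ]
    exact existsUnique_rightDescent hw

open Finsupp

section Operators

/-- Finitely supported functions supported on the sphere of radius `k`. -/
def grade (L k : ℕ) : Submodule ℂ (W L →₀ ℂ) := Finsupp.supported ℂ ℂ {w | len w = k}

theorem single_mem_grade {k : ℕ} {w : W L} (hw : len w = k) (a : ℂ) : single w a ∈ grade L k :=
  Finsupp.single_mem_supported ℂ a hw

theorem grade_eq_span (k : ℕ) :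
    grade L k = Submodule.span ℂ ((fun w => single w (1 : ℂ)) '' {w | len w = k}) :=
  Finsupp.supported_eq_span_single ℂ _

variable {E : Type*} [AddCommGroup E] [Module ℂ E]

theorem map_mem_of_grade {k : ℕ} (F : (W L →₀ ℂ) →ₗ[ℂ] E) (P : Submodule ℂ E)
    (hF : ∀ w, len w = k → F (single w 1) ∈ P) {f : W L →₀ ℂ} (hf : f ∈ grade L k) :
    F f ∈ P := by
  rw [grade_eq_span] at hf
  have : Submodule.span ℂ ((fun w => single w (1 : ℂ)) '' {w : W L | len w = k}) ≤ P.comap F := by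
    rw [Submodule.span_le]
    rintro _ ⟨w, hw, rfl⟩
    exact hF w hw
  exact this hf

theorem eq_of_eq_on_grade {k : ℕ} (F G : (W L →₀ ℂ) →ₗ[ℂ] E)
    (hFG : ∀ w, len w = k → F (single w 1) = G (single w 1)) {f : W L →₀ ℂ}
    (hf : f ∈ grade L k) : F f = G f := by
  have := map_mem_of_grade (F - G) ⊥ (fun w hw => by simp [hFG w hw]) hf
  simpa [sub_eq_zero] using this

theorem map_sum_ite {ι : Type*} [Fintype ι] {D : Type*} [AddCommGroup D] [Module ℂ D]
    (F : D →ₗ[ℂ] E) (c : ι → Prop) [DecidablePred c] (x : ι → D) :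
    F (∑ s, if c s then x s else 0) = ∑ s, if c s then F (x s) else 0 := by
  simp only [map_sum, apply_ite F, map_zero]

theorem sum_ite_sum_ite {ι A : Type*} [AddCommMonoid A] [Fintype ι] (c : ι → Prop) [DecidablePred c]
    (d : ι → ι → Prop) [∀ i, DecidablePred (d i)] (x : ι → ι → A) :
    (∑ s, if c s then ∑ t, (if d s t then x s t else 0) else 0) =
      ∑ s, ∑ t, if c s ∧ d s t then x s t else 0 := by
  refine Finset.sum_congr rfl fun s _ => ?_
  by_cases h : c s <;> simp [h]

/-- The length-increasing part of the sum of the simple reflections. -/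
def raise (α : W L → W L → W L) : Module.End ℂ (W L →₀ ℂ) :=
  Finsupp.linearCombination ℂ fun w =>
    ∑ s, if len w < len (α (σ s) w) then single (α (σ s) w) 1 else 0

/-- The length-decreasing part of the sum of the simple reflections. -/
def lower (α : W L → W L → W L) : Module.End ℂ (W L →₀ ℂ) :=
  Finsupp.linearCombination ℂ fun w =>
    ∑ s, if len (α (σ s) w) < len w then single (α (σ s) w) 1 else 0

theorem raise_single (α : W L → W L → W L) (w : W L) :
    raise α (single w 1) =
      ∑ s, if len w < len (α (σ s) w) then single (α (σ s) w) 1 else 0 := by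
  simp [raise]

theorem lower_single (α : W L → W L → W L) (w : W L) :
    lower α (single w 1) =
      ∑ s, if len (α (σ s) w) < len w then single (α (σ s) w) 1 else 0 := by
  simp [lower]

variable {α : W L → W L → W L}

theorem raise_mem_grade (hα : LengthAction α) {k : ℕ} {f : W L →₀ ℂ} (hf : f ∈ grade L k) :
    raise α f ∈ grade L (k + 1) := by
  refine map_mem_of_grade _ _ (fun w hw => ?_) hf
  rw [raise_single]
  refine Submodule.sum_mem _ fun s _ => ?_
  split_ifs with hs
  · refine single_mem_grade ?_ _
    have := hα.len_simple s w
    omega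
  · exact Submodule.zero_mem _

theorem raise_pow_mem_grade (hα : LengthAction α) {k : ℕ} {f : W L →₀ ℂ} (hf : f ∈ grade L k)
    (m : ℕ) : (raise α ^ m) f ∈ grade L (k + m) := by
  induction m with
  | zero => simpa using hf
  | succ m ih =>
    rw [pow_succ']
    exact raise_mem_grade hα ih

theorem lower_mem_grade (hα : LengthAction α) {k : ℕ} {f : W L →₀ ℂ} (hf : f ∈ grade L (k + 1)) :
    lower α f ∈ grade L k := by
  refine map_mem_of_grade _ _ (fun w hw => ?_) hf
  rw [lower_single]
  refine Submodule.sum_mem _ fun s _ => ?_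
  split_ifs with hs
  · refine single_mem_grade ?_ _
    have := hα.len_simple s w
    omega
  · exact Submodule.zero_mem _

theorem lower_raise (hα : LengthAction α) {k : ℕ} (hk : k ≠ 0) {f : W L →₀ ℂ}
    (hf : f ∈ grade L k) : lower α (raise α f) = ((L : ℂ) - 1) • f := by
  refine eq_of_eq_on_grade (lower α ∘ₗ raise α) (((L : ℂ) - 1) • LinearMap.id) (fun w hw => ?_) hf
  obtain ⟨r, hr, hr'⟩ := hα.descent w (by omega)
  have key : ∀ s, lower α (if len w < len (α (σ s) w) then single (α (σ s) w) (1 : ℂ) else 0) =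
      single w 1 - if s = r then single w 1 else 0 := by
    intro s
    have h1 := hα.len_simple s w
    by_cases hs : s = r
    · subst hs
      rw [if_neg (by omega), if_pos rfl, map_zero, sub_self]
    · have h2 : len w < len (α (σ s) w) := by
        by_contra h
        exact hs (hr' s (show _ < _ by omega))
      rw [if_pos h2, if_neg hs, sub_zero, lower_single, Finset.sum_eq_single s]
      · rw [hα.simple_simple, if_pos h2]
      · intro t _ hts
        refine if_neg fun ht => hts ?_
        refine (hα.descent (α (σ s) w) (by omega)).unique ht ?_
        rwa [hα.simple_simple]
      · simp
  simp only [LinearMap.comp_apply, raise_single, map_sum, key, Finset.sum_sub_distrib,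
    Finset.sum_const, Finset.card_univ, Fintype.card_fin, Finset.sum_ite_eq', Finset.mem_univ,
    if_true, LinearMap.smul_apply, LinearMap.id_apply, sub_smul, one_smul, Nat.cast_smul_eq_nsmul]

theorem lower_pow_raise_pow (hα : LengthAction α) {k : ℕ} (hk : k ≠ 0) {f : W L →₀ ℂ}
    (hf : f ∈ grade L k) (m : ℕ) :
    (lower α ^ m) ((raise α ^ m) f) = ((L : ℂ) - 1) ^ m • f := by
  induction m with
  | zero => simp
  | succ m ih =>
    rw [pow_succ, pow_succ', Module.End.mul_apply, Module.End.mul_apply,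
      lower_raise hα (by omega) (raise_pow_mem_grade hα hf m), map_smul, ih, smul_smul, pow_succ']

theorem raise_comm :
    Commute (raise (leftAct (L := L))) (raise (rightAct (L := L))) := by
  refine Finsupp.lhom_ext' fun w => LinearMap.ext_ring ?_
  simp only [LinearMap.comp_apply, Finsupp.lsingle_apply, Module.End.mul_apply, raise_single,
    map_sum_ite, sum_ite_sum_ite]
  rw [Finset.sum_comm]
  refine Finset.sum_congr rfl fun s _ => Finset.sum_congr rfl fun t _ => ?_
  refine if_congr ?_ (by simp only [leftAct, rightAct_σ, mul_assoc]) rfl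
  simp only [leftAct, rightAct_σ]
  have h3 := len_σ_mul s w
  have h4 := len_mul_σ' t w
  have h5 := len_σ_mul s (w * σ t)
  have h6 := len_mul_σ' t (σ s * w)
  rw [mul_assoc] at h6 ⊢
  omega

theorem lower_left_raise_right {k : ℕ} (hk : 2 ≤ k) {f : W L →₀ ℂ} (hf : f ∈ grade L k) :
    lower leftAct (raise rightAct f) = raise rightAct (lower leftAct f) := by
  refine eq_of_eq_on_grade (lower leftAct ∘ₗ raise rightAct) (raise rightAct ∘ₗ lower leftAct)
    (fun w hw => ?_) hf
  simp only [LinearMap.comp_apply, raise_single, lower_single, map_sum_ite, sum_ite_sum_ite]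
  rw [Finset.sum_comm]
  refine Finset.sum_congr rfl fun s _ => Finset.sum_congr rfl fun t _ => ?_
  refine if_congr ?_ (by simp only [leftAct, rightAct_σ, mul_assoc]) rfl
  simpa only [leftAct, rightAct_σ] using descent_ascent_comm (by omega) s t

theorem lower_right_raise_left {k : ℕ} (hk : 2 ≤ k) {f : W L →₀ ℂ} (hf : f ∈ grade L k) :
    lower rightAct (raise leftAct f) = raise leftAct (lower rightAct f) := by
  refine eq_of_eq_on_grade (lower rightAct ∘ₗ raise leftAct) (raise leftAct ∘ₗ lower rightAct)
    (fun w hw => ?_) hf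
  simp only [LinearMap.comp_apply, raise_single, lower_single, map_sum_ite, sum_ite_sum_ite]
  rw [Finset.sum_comm]
  refine Finset.sum_congr rfl fun t _ => Finset.sum_congr rfl fun s _ => ?_
  refine if_congr ?_ (by simp only [leftAct, rightAct_σ, mul_assoc]) rfl
  simpa only [leftAct, rightAct_σ] using descent_ascent_comm' (by omega) s t

theorem lower_raise_pow_eq_zero {α β : W L → W L → W L} (hβ : LengthAction β)
    (hcomm : ∀ k, 2 ≤ k → ∀ f ∈ grade L k, lower α (raise β f) = raise β (lower α f))
    {k : ℕ} (hk : 2 ≤ k) {f : W L →₀ ℂ} (hf : f ∈ grade L k) (h0 : lower α f = 0) (m : ℕ) :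
    lower α ((raise β ^ m) f) = 0 := by
  induction m with
  | zero => simpa using h0
  | succ m ih =>
    rw [pow_succ', Module.End.mul_apply,
      hcomm _ (by omega) _ (raise_pow_mem_grade hβ hf m), ih, map_zero]

end Operators

section Inner

/-- The embedding of finitely supported functions into `ℓ²(W)`. -/
def toH (L : ℕ) : (W L →₀ ℂ) →ₗ[ℂ] H L := Finsupp.linearCombination ℂ δ

@[simp]
theorem toH_single (w : W L) (a : ℂ) : toH L (single w a) = a • δ w := by
  simp [toH]

theorem V_eq_map_grade (k : ℕ) : V L k = (grade L k).map (toH L) := by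
  rw [grade_eq_span, Submodule.map_span, V]
  congr 1
  ext x
  simp [eq_comm]

open scoped Classical in
theorem inner_δ (u v : W L) : ⟪δ u, δ v⟫ = if u = v then (1 : ℂ) else 0 := by
  rw [δ, δ, lp.inner_single_left, lp.single_apply, Pi.single_apply]
  split_ifs <;> simp

open scoped Classical in
theorem inner_toH_single (f : W L →₀ ℂ) (w : W L) : ⟪toH L f, δ w⟫ = starRingEnd ℂ (f w) := by
  induction f using Finsupp.induction_linear with
  | zero => simp
  | add f g hf hg => simp only [map_add, inner_add_left, Finsupp.add_apply, hf, hg]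
  | single u a =>
    rw [toH_single, inner_smul_left, inner_δ, Finsupp.single_apply]
    split_ifs <;> simp

theorem inner_toH_of_grade_ne {i j : ℕ} (hij : i ≠ j) {f g : W L →₀ ℂ} (hf : f ∈ grade L i)
    (hg : g ∈ grade L j) : ⟪toH L f, toH L g⟫ = 0 := by
  refine eq_of_eq_on_grade (innerₛₗ ℂ (toH L f) ∘ₗ toH L) (0 : _ →ₗ[ℂ] ℂ) (fun w hw => ?_) hg
  have : f w = 0 := by
    by_contra h
    exact hij ((hf (Finsupp.mem_support_iff.2 h)).symm.trans hw)
  simp [inner_toH_single, this]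

theorem inner_raise {α : W L → W L → W L} (hα : LengthAction α) (f g : W L →₀ ℂ) :
    ⟪toH L (raise α f), toH L g⟫ = ⟪toH L f, toH L (lower α g)⟫ := by
  classical
  induction f using Finsupp.induction_linear with
  | zero => simp
  | add f f' hf hf' => simp only [map_add, inner_add_left, hf, hf']
  | single w a =>
    induction g using Finsupp.induction_linear with
    | zero => simp
    | add g g' hg hg' => simp only [map_add, inner_add_right, hg, hg']
    | single u b =>
      have key : ⟪toH L (raise α (single w 1)), δ u⟫ = ⟪δ w, toH L (lower α (single u 1))⟫ := by
        simp only [raise_single, lower_single, map_sum_ite, sum_inner, inner_sum, toH_single,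
          one_smul]
        refine Finset.sum_congr rfl fun s _ => ?_
        rw [apply_ite (fun x : H L => ⟪x, δ u⟫), apply_ite (fun x : H L => ⟪δ w, x⟫), inner_δ,
          inner_δ, inner_zero_left, inner_zero_right]
        by_cases h : α (σ s) w = u
        · subst h
          simp [hα.simple_simple]
        · have : w ≠ α (σ s) u := by
            rintro rfl
            exact h (hα.simple_simple s u)
          simp [h, this]
      rw [← mul_one a, ← mul_one b, ← smul_eq_mul, ← smul_eq_mul, ← Finsupp.smul_single,
        ← Finsupp.smul_single]
      simp only [map_smul, inner_smul_left, inner_smul_right, toH_single, one_smul, key]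

theorem inner_lower {α : W L → W L → W L} (hα : LengthAction α) (f g : W L →₀ ℂ) :
    ⟪toH L (lower α f), toH L g⟫ = ⟪toH L f, toH L (raise α g)⟫ := by
  rw [← inner_conj_symm, ← inner_raise hα, inner_conj_symm]

theorem inner_raise_pow {α : W L → W L → W L} (hα : LengthAction α) (f g : W L →₀ ℂ) (m : ℕ) :
    ⟪toH L ((raise α ^ m) f), toH L g⟫ = ⟪toH L f, toH L ((lower α ^ m) g)⟫ := by
  induction m generalizing g with
  | zero => simp
  | succ m ih =>
    rw [pow_succ', Module.End.mul_apply, inner_raise hα, ih, pow_succ, Module.End.mul_apply]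

theorem inner_raise_pow_raise_pow {α : W L → W L → W L} (hα : LengthAction α)
    (f : W L →₀ ℂ) {g : W L →₀ ℂ} {k : ℕ} (hk : k ≠ 0) (hg : g ∈ grade L k) (m : ℕ) :
    ⟪toH L ((raise α ^ m) f), toH L ((raise α ^ m) g)⟫ =
      ((L : ℂ) - 1) ^ m * ⟪toH L f, toH L g⟫ := by
  rw [inner_raise_pow hα, lower_pow_raise_pow hα hk hg, map_smul, inner_smul_right]

theorem inner_raise_pow_eq_zero {α β : W L → W L → W L} (hα : LengthAction α)
    (hβ : LengthAction β)
    (hcomm : ∀ k, 2 ≤ k → ∀ f ∈ grade L k, lower α (raise β f) = raise β (lower α f))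
    {k : ℕ} (hk : 2 ≤ k) {f : W L →₀ ℂ} (hf : f ∈ grade L k) (h0 : lower α f = 0) (m d : ℕ)
    (hd : d ≠ 0) (g : W L →₀ ℂ) :
    ⟪toH L ((raise β ^ m) f), toH L ((raise α ^ d) g)⟫ = 0 := by
  obtain ⟨d, rfl⟩ := Nat.exists_eq_succ_of_ne_zero hd
  rw [pow_succ', Module.End.mul_apply, ← inner_lower hα,
    lower_raise_pow_eq_zero hβ hcomm hk hf h0, map_zero, inner_zero_left]

theorem inner_raise_raise {l : ℕ} (hl : 2 ≤ l) {f g : W L →₀ ℂ} (hf : f ∈ grade L l)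
    (hg : g ∈ grade L l) (hleft : lower leftAct f = 0) (hright : lower rightAct f = 0)
    (m n m' n' : ℕ) :
    ⟪toH L ((raise leftAct ^ m) ((raise rightAct ^ n) f)),
      toH L ((raise leftAct ^ m') ((raise rightAct ^ n') g))⟫ =
      if m = m' ∧ n = n' then ((L : ℂ) - 1) ^ (m + n) * ⟪toH L f, toH L g⟫ else 0 := by
  have hA := lengthAction_leftAct (L := L)
  have hB := lengthAction_rightAct (L := L)
  have hBf := raise_pow_mem_grade hB hf n
  have hBg := raise_pow_mem_grade hB hg n'
  by_cases hmn : m + n = m' + n'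
  · rcases lt_trichotomy m m' with h | rfl | h
    · obtain ⟨d, rfl⟩ := Nat.exists_eq_add_of_le h.le
      rw [if_neg (by omega), pow_add, Module.End.mul_apply,
        inner_raise_pow_raise_pow hA _ (k := l + n' + d) (by omega)
          (raise_pow_mem_grade hA hBg d),
        inner_raise_pow_eq_zero hA hB (fun k hk f => lower_left_raise_right hk) hl hf hleft n d
          (by omega), mul_zero]
    · obtain rfl : n = n' := by omega
      rw [if_pos ⟨rfl, rfl⟩, inner_raise_pow_raise_pow hA _ (by omega) hBg,
        inner_raise_pow_raise_pow hB _ (by omega) hg, pow_add, mul_assoc]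
    · obtain ⟨d, rfl⟩ := Nat.exists_eq_add_of_le h.le
      obtain rfl : n' = n + d := by omega
      rw [if_neg (by omega), pow_add, Module.End.mul_apply,
        inner_raise_pow_raise_pow hA _ (by omega) hBg, ← Module.End.mul_apply,
        (raise_comm.pow_pow d n).eq, pow_add, Module.End.mul_apply, Module.End.mul_apply,
        inner_raise_pow_raise_pow hB _ (k := l + d) (by omega) (raise_pow_mem_grade hB hg d),
        inner_raise_pow_eq_zero hB hA (fun k hk f => lower_right_raise_left hk) hl hf hright d d
          (by omega), mul_zero, mul_zero]
  · rw [if_neg (by omega)]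
    exact inner_toH_of_grade_ne (by omega) (raise_pow_mem_grade hA hBf m)
      (raise_pow_mem_grade hA hBg m')

end Inner

section Leading

theorem finite_sphere (n : ℕ) : {w : W L | len w = n}.Finite := by
  refine ((List.finite_length_eq (Fin L) n).image (cs L).wordProd).subset ?_
  intro w hw
  obtain ⟨ω, hω, rfl⟩ := (cs L).exists_isReduced w
  exact ⟨ω, hω.eq.symm.trans hw, rfl⟩

/-- The sphere of radius `n` as a finite set. -/
def sphere (L n : ℕ) : Finset (W L) := (finite_sphere n).toFinset

@[simp]
theorem mem_sphere {n : ℕ} {w : W L} : w ∈ sphere L n ↔ len w = n := by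
  simp [sphere]

theorem tsum_sphere {E : Type*} [AddCommMonoid E] [TopologicalSpace E] (n : ℕ) (F : W L → E) :
    ∑' w : {w : W L // len w = n}, F w = ∑ w ∈ sphere L n, F w := by
  have := (finite_sphere (L := L) n).fintype
  change ∑' w : {w : W L | len w = n}, F w = _
  rw [tsum_fintype]
  exact (Finset.sum_subtype _ (fun _ => mem_sphere) F).symm

theorem sum_sphere_succ {E : Type*} [AddCommGroup E] (n : ℕ) (F : W L → E) :
    ∑ w ∈ sphere L (n + 1), F w =
      ∑ u ∈ sphere L n, ∑ s, if len u < len (σ s * u) then F (σ s * u) else 0 := by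
  have h1 : ∀ w ∈ sphere L (n + 1), F w = ∑ s, if len (σ s * w) < len w then F w else 0 := by
    intro w hw
    obtain ⟨r, hr, hr'⟩ := existsUnique_leftDescent (w := w) (by rw [mem_sphere] at hw; omega)
    rw [Finset.sum_eq_single r, if_pos hr]
    · exact fun s _ hs => if_neg fun h => hs (hr' s h)
    · simp
  rw [Finset.sum_congr rfl h1, Finset.sum_comm, Finset.sum_comm (s := sphere L n)]
  refine Finset.sum_congr rfl fun s _ => ?_
  have hσ : ∀ w : W L, σ s * (σ s * w) = w := fun w => by rw [← mul_assoc, σ_mul_self, one_mul]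
  rw [← Finset.sum_filter, ← Finset.sum_filter]
  refine Finset.sum_nbij' (σ s * ·) (σ s * ·) ?_ ?_ (fun w _ => hσ w) (fun w _ => hσ w) ?_
  · intro w hw
    simp only [Finset.mem_filter, mem_sphere, hσ] at hw ⊢
    have := len_σ_mul s w
    omega
  · intro w hw
    simp only [Finset.mem_filter, mem_sphere, hσ] at hw ⊢
    have := len_σ_mul s w
    omega
  · intro w _
    rw [hσ]

variable {α : W L → W L → W L}

theorem len_act_le (hα : LengthAction α) (u w : W L) : len (α u w) ≤ len u + len w := by
  induction h : len u generalizing u with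
  | zero => rw [len_eq_zero.1 h, hα.one_act]; omega
  | succ n ih =>
    obtain ⟨s, hs, -⟩ := existsUnique_leftDescent (w := u) (by omega)
    have h1 := len_σ_mul s u
    have h2 := ih (σ s * u) (by omega)
    have h3 := hα.len_simple s (α u w)
    rw [← hα.mul_act] at h3
    omega

theorem raise_pow_single (hα : LengthAction α) (m : ℕ) (w : W L) :
    (raise α ^ m) (single w 1) =
      ∑ u ∈ sphere L m, if len (α u w) = len u + len w then single (α u w) 1 else 0 := by
  induction m with
  | zero =>
    have : sphere L 0 = {1} := by
      ext w
      simp [len_eq_zero]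
    simp [this, hα.one_act, len_eq_zero.2 rfl]
  | succ m ih =>
    rw [pow_succ', Module.End.mul_apply, ih, sum_sphere_succ, map_sum]
    refine Finset.sum_congr rfl fun u _ => ?_
    have h1 := len_act_le hα u w
    split_ifs with h
    · rw [raise_single]
      refine Finset.sum_congr rfl fun s _ => ?_
      have h2 := hα.len_simple s (α u w)
      have h3 := len_act_le hα (σ s * u) w
      have h4 := len_σ_mul s u
      rw [hα.mul_act] at h3 ⊢
      split_ifs <;> first | rfl | omega
    · rw [map_zero, Finset.sum_eq_zero]
      intro s _
      have h2 := hα.len_simple s (α u w)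
      have h4 := len_σ_mul s u
      rw [hα.mul_act]
      split_ifs <;> first | rfl | omega

/-- The span of the basis vectors of length less than `k`. -/
def lowerSpan (L k : ℕ) : Submodule ℂ (H L) :=
  Submodule.span ℂ {x : H L | ∃ w : W L, len w < k ∧ x = δ w}

theorem δ_mem_lowerSpan {k : ℕ} {w : W L} (hw : len w < k) : δ w ∈ lowerSpan L k :=
  Submodule.subset_span ⟨w, hw, rfl⟩

theorem lowerSpan_mono {j k : ℕ} (hjk : j ≤ k) : lowerSpan L j ≤ lowerSpan L k := by
  refine Submodule.span_mono ?_
  rintro _ ⟨w, hw, rfl⟩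
  exact ⟨w, hw.trans_le hjk, rfl⟩

theorem map_mem_of_lowerSpan {k : ℕ} (F : H L →L[ℂ] H L) (P : Submodule ℂ (H L))
    (hF : ∀ w, len w < k → F (δ w) ∈ P) {x : H L} (hx : x ∈ lowerSpan L k) : F x ∈ P := by
  have : lowerSpan L k ≤ P.comap (F : H L →ₗ[ℂ] H L) := by
    rw [lowerSpan, Submodule.span_le]
    rintro _ ⟨w, hw, rfl⟩
    exact hF w hw
  exact this hx

variable {p : ℂ} {T : Fin L → H L →L[ℂ] H L} {Tw : W L → H L →L[ℂ] H L}

theorem apply_δ_sub_mem_lowerSpan (hα : LengthAction α)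
    (hT : ∀ s w, T s (δ w) =
      if len (α (σ s) w) < len w then δ (α (σ s) w) + p • δ w else δ (α (σ s) w))
    (hTw1 : Tw 1 = 1)
    (hTwrec : ∀ s w, len (σ s * w) < len w → Tw w = T s ∘L Tw (σ s * w)) (u w : W L) :
    Tw u (δ w) - (if len (α u w) = len u + len w then δ (α u w) else 0) ∈
      lowerSpan L (len u + len w) := by
  have hTlow : ∀ s k x, x ∈ lowerSpan L k → T s x ∈ lowerSpan L (k + 1) := by
    intro s k x hx
    refine map_mem_of_lowerSpan _ _ (fun w hw => ?_) hx
    have h1 := hα.len_simple s w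
    rw [hT]
    split_ifs with h
    · exact Submodule.add_mem _ (δ_mem_lowerSpan (by omega))
        (Submodule.smul_mem _ _ (δ_mem_lowerSpan (by omega)))
    · exact δ_mem_lowerSpan (by omega)
  induction h : len u generalizing u with
  | zero =>
    obtain rfl := len_eq_zero.1 h
    simp [hTw1, hα.one_act]
  | succ n ih =>
    obtain ⟨s, hs, -⟩ := existsUnique_leftDescent (w := u) (by omega)
    have h1 := len_σ_mul s u
    have h2 := hTlow s _ _ (ih (σ s * u) (by omega))
    have h3 := hα.len_simple s (α (σ s * u) w)
    have h4 : α (σ s) (α (σ s * u) w) = α u w := by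
      rw [← hα.mul_act, ← mul_assoc, σ_mul_self, one_mul]
    have h5 := len_act_le hα (σ s * u) w
    rw [h4] at h3
    have h6 : T s (if len (α (σ s * u) w) = n + len w then δ (α (σ s * u) w) else 0) -
        (if len (α u w) = n + 1 + len w then δ (α u w) else 0) ∈
          lowerSpan L (n + 1 + len w) := by
      by_cases h7 : len (α (σ s * u) w) = n + len w
      · rw [if_pos h7, hT, h4]
        by_cases h8 : len (α u w) < len (α (σ s * u) w)
        · rw [if_pos h8, if_neg (by omega), sub_zero]
          exact Submodule.add_mem _ (δ_mem_lowerSpan (by omega))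
            (Submodule.smul_mem _ _ (δ_mem_lowerSpan (by omega)))
        · rw [if_neg h8, if_pos (by omega), sub_self]
          exact Submodule.zero_mem _
      · rw [if_neg h7, if_neg (by omega), map_zero, sub_zero]
        exact Submodule.zero_mem _
    rw [map_sub] at h2
    have h9 := Submodule.add_mem _ (lowerSpan_mono (by omega) h2) h6
    rwa [sub_add_sub_cancel, ← ContinuousLinearMap.comp_apply, ← hTwrec s u hs] at h9

variable {hn : ℕ → H L →L[ℂ] H L}

theorem sphere_sum_sub_raise_pow_mem (hα : LengthAction α)
    (hT : ∀ s w, T s (δ w) =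
      if len (α (σ s) w) < len w then δ (α (σ s) w) + p • δ w else δ (α (σ s) w))
    (hTw1 : Tw 1 = 1)
    (hTwrec : ∀ s w, len (σ s * w) < len w → Tw w = T s ∘L Tw (σ s * w))
    (hhn : ∀ n, hn n = ∑ w ∈ sphere L n, Tw w) (m : ℕ) {k : ℕ} {f : W L →₀ ℂ}
    (hf : f ∈ grade L k) :
    hn m (toH L f) - toH L ((raise α ^ m) f) ∈ lowerSpan L (m + k) := by
  refine map_mem_of_grade ((hn m : H L →ₗ[ℂ] H L) ∘ₗ toH L - toH L ∘ₗ (raise α ^ m)) _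
    (fun w hw => ?_) hf
  have h1 : hn m (δ w) - ∑ u ∈ sphere L m, (if len (α u w) = len u + len w then δ (α u w) else 0) ∈
      lowerSpan L (m + k) := by
    rw [hhn, _root_.sum_apply, ← Finset.sum_sub_distrib]
    refine Submodule.sum_mem _ fun u hu => ?_
    have := apply_δ_sub_mem_lowerSpan hα hT hTw1 hTwrec u w
    rw [mem_sphere] at hu
    rwa [hu, hw] at this ⊢
  simpa [raise_pow_single hα, apply_ite (toH L)] using h1

theorem sphere_sum_mem_lowerSpan (hα : LengthAction α)
    (hT : ∀ s w, T s (δ w) =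
      if len (α (σ s) w) < len w then δ (α (σ s) w) + p • δ w else δ (α (σ s) w))
    (hTw1 : Tw 1 = 1)
    (hTwrec : ∀ s w, len (σ s * w) < len w → Tw w = T s ∘L Tw (σ s * w))
    (hhn : ∀ n, hn n = ∑ w ∈ sphere L n, Tw w) (m : ℕ) {k : ℕ} {x : H L}
    (hx : x ∈ lowerSpan L k) : hn m x ∈ lowerSpan L (m + k) := by
  refine map_mem_of_lowerSpan _ _ (fun w hw => ?_) hx
  rw [hhn, _root_.sum_apply]
  refine Submodule.sum_mem _ fun u hu => ?_
  rw [mem_sphere] at hu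
  have h1 := apply_δ_sub_mem_lowerSpan hα hT hTw1 hTwrec u w
  rw [← sub_add_cancel (Tw u (δ w)) (if len (α u w) = len u + len w then δ (α u w) else 0)]
  refine Submodule.add_mem _ (lowerSpan_mono (by omega) h1) ?_
  split_ifs
  · exact δ_mem_lowerSpan (by omega)
  · exact Submodule.zero_mem _

variable {Q : ℕ → H L →L[ℂ] H L}

theorem proj_toH_of_grade (hQ : ∀ l w, Q l (δ w) = if len w = l then δ w else 0) {k : ℕ}
    {f : W L →₀ ℂ} (hf : f ∈ grade L k) : Q k (toH L f) = toH L f :=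
  eq_of_eq_on_grade ((Q k : H L →ₗ[ℂ] H L) ∘ₗ toH L) (toH L)
    (fun w hw => by simp [hQ, hw]) hf

theorem proj_of_lowerSpan (hQ : ∀ l w, Q l (δ w) = if len w = l then δ w else 0) {k : ℕ}
    {x : H L} (hx : x ∈ lowerSpan L k) : Q k x = 0 := by
  refine (Submodule.mem_bot ℂ).1 (map_mem_of_lowerSpan (Q k) ⊥ (fun w hw => ?_) hx)
  rw [hQ, if_neg hw.ne]
  exact Submodule.zero_mem _

theorem lower_eq_zero_of_orthogonal (hα : LengthAction α)
    (hT : ∀ s w, T s (δ w) =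
      if len (α (σ s) w) < len w then δ (α (σ s) w) + p • δ w else δ (α (σ s) w))
    (hQ : ∀ l w, Q l (δ w) = if len w = l then δ w else 0) {k : ℕ} {f : W L →₀ ℂ}
    (hf : f ∈ grade L (k + 1))
    (hperp : ∀ y ∈ V L k, ⟪toH L f, Q (k + 1) ((∑ s, T s) y)⟫ = 0) : lower α f = 0 := by
  ext w
  by_cases hw : len w = k
  · have h1 := hperp (δ w) (Submodule.subset_span ⟨w, hw, rfl⟩)
    have h2 : Q (k + 1) ((∑ s, T s) (δ w)) = toH L (raise α (single w 1)) := by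
      rw [raise_single, map_sum_ite, _root_.sum_apply, map_sum]
      refine Finset.sum_congr rfl fun s _ => ?_
      have h3 := hα.len_simple s w
      rw [hT, toH_single, one_smul]
      by_cases h4 : len (α (σ s) w) < len w
      · rw [if_pos h4, if_neg (by omega), map_add, map_smul, hQ, hQ, if_neg (by omega),
          if_neg (by omega), smul_zero, add_zero]
      · rw [if_neg h4, if_pos (by omega), hQ, if_pos (by omega)]
    rw [h2, ← inner_lower hα, toH_single, one_smul, inner_toH_single] at h1
    simpa using h1
  · by_contra h
    exact hw (lower_mem_grade hα hf (Finsupp.mem_support_iff.2 h))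

theorem proj_sphere_sum_sphere_sum {α β : W L → W L → W L} (hα : LengthAction α)
    (hβ : LengthAction β) {S : Fin L → H L →L[ℂ] H L} {Sw : W L → H L →L[ℂ] H L}
    {hm : ℕ → H L →L[ℂ] H L}
    (hT : ∀ s w, T s (δ w) =
      if len (α (σ s) w) < len w then δ (α (σ s) w) + p • δ w else δ (α (σ s) w))
    (hTw1 : Tw 1 = 1)
    (hTwrec : ∀ s w, len (σ s * w) < len w → Tw w = T s ∘L Tw (σ s * w))
    (hhn : ∀ n, hn n = ∑ w ∈ sphere L n, Tw w)
    (hS : ∀ s w, S s (δ w) =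
      if len (β (σ s) w) < len w then δ (β (σ s) w) + p • δ w else δ (β (σ s) w))
    (hSw1 : Sw 1 = 1)
    (hSwrec : ∀ s w, len (σ s * w) < len w → Sw w = S s ∘L Sw (σ s * w))
    (hhm : ∀ n, hm n = ∑ w ∈ sphere L n, Sw w)
    (hQ : ∀ l w, Q l (δ w) = if len w = l then δ w else 0)
    {l : ℕ} {f : W L →₀ ℂ} (hf : f ∈ grade L l) (m n : ℕ) :
    Q (m + n + l) (hn m (hm n (toH L f))) = toH L ((raise α ^ m) ((raise β ^ n) f)) := by
  have h1 := sphere_sum_sub_raise_pow_mem hβ hS hSw1 hSwrec hhm n hf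
  have hg := raise_pow_mem_grade hβ hf n
  have h2 := sphere_sum_sub_raise_pow_mem hα hT hTw1 hTwrec hhn m hg
  have h3 := sphere_sum_mem_lowerSpan hα hT hTw1 hTwrec hhn m h1
  have h4 := raise_pow_mem_grade hα hg m
  rw [map_sub] at h3
  rw [add_comm l n, ← add_assoc] at h2
  rw [← add_assoc] at h3
  rw [show l + n + m = m + n + l by ring] at h4
  have h5 := proj_of_lowerSpan hQ (Submodule.add_mem _ h3 h2)
  rwa [sub_add_sub_cancel, map_sub, proj_toH_of_grade hQ h4, sub_eq_zero] at h5

end Leading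

theorem statement12
    (L : ℕ) (hL : 3 ≤ L) (q p : ℝ) (hq : 0 < q) (hq1 : q ≤ 1)
    (hp : p = (q - 1) / Real.sqrt q)
    (T : Fin L → H L →L[ℂ] H L)
    (hT : ∀ (s : Fin L) (w : W L),
      T s (δ w) =
        if len (σ s * w) < len w then δ (σ s * w) + (p : ℂ) • δ w else δ (σ s * w))
    (h : H L →L[ℂ] H L) (hh : h = ∑ s, T s)
    (Tw : W L → H L →L[ℂ] H L) (hTw1 : Tw 1 = 1)
    (hTwrec : ∀ (s : Fin L) (w : W L), len (σ s * w) < len w →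
      Tw w = T s ∘L Tw (σ s * w))
    (hn : ℕ → H L →L[ℂ] H L)
    (hhn : ∀ n : ℕ, hn n = ∑' w : {w : W L // len w = n}, Tw (w : W L))
    (Tr : Fin L → H L →L[ℂ] H L)
    (hTr : ∀ (s : Fin L) (w : W L),
      Tr s (δ w) =
        if len (w * σ s) < len w then δ (w * σ s) + (p : ℂ) • δ w else δ (w * σ s))
    (Rh : H L →L[ℂ] H L) (hRh : Rh = ∑ s, Tr s)
    (Twr : W L → H L →L[ℂ] H L) (hTwr1 : Twr 1 = 1)
    (hTwrrec : ∀ (s : Fin L) (w : W L), len (w * σ s) < len w →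
      Twr w = Tr s ∘L Twr (w * σ s))
    (hnr : ℕ → H L →L[ℂ] H L)
    (hhnr : ∀ n : ℕ, hnr n = ∑' w : {w : W L // len w = n}, Twr (w : W L))
    (Q : ℕ → H L →L[ℂ] H L)
    (hQ : ∀ (l : ℕ) (w : W L), Q l (δ w) = if len w = l then δ w else 0)
    (l : ℕ) (hl : 2 ≤ l) (ξ : H L)
    (hξmem : ξ ∈ V L l)
    (hξperp : ∀ y ∈ Sl L Q h Rh l, ⟪ξ, y⟫ = 0)
    (ξ' : H L) (hξ'mem : ξ' ∈ V L l)
    (m n m' n' : ℕ) :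
    ⟪Q (m + n + l) (hn m (hnr n ξ)), Q (m' + n' + l) (hn m' (hnr n' ξ'))⟫ =
      if m = m' ∧ n = n' then (((L : ℂ) - 1) ^ (m + n)) * ⟪ξ, ξ'⟫ else 0 := by
  rw [V_eq_map_grade] at hξmem hξ'mem
  obtain ⟨f, hf, rfl⟩ := hξmem
  obtain ⟨g, hg, rfl⟩ := hξ'mem
  have hA := lengthAction_leftAct (L := L)
  have hB := lengthAction_rightAct (L := L)
  have hTr' : ∀ s w, Tr s (δ w) = if len (rightAct (σ s) w) < len w then
      δ (rightAct (σ s) w) + (p : ℂ) • δ w else δ (rightAct (σ s) w) := by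
    intro s w
    rw [rightAct_σ]
    exact hTr s w
  have hTwr1' : Twr 1⁻¹ = 1 := by rw [inv_one, hTwr1]
  have hTwrrec' : ∀ s w, len (σ s * w) < len w → Twr w⁻¹ = Tr s ∘L Twr (σ s * w)⁻¹ := by
    intro s w hs
    rw [mul_inv_rev, σ_inv]
    refine hTwrrec s w⁻¹ ?_
    rwa [len_mul_σ, inv_inv, len_inv]
  have hhn' : ∀ n, hn n = ∑ w ∈ sphere L n, Tw w := fun n => by rw [hhn, tsum_sphere]
  have hhnr' : ∀ n, hnr n = ∑ w ∈ sphere L n, Twr w⁻¹ := by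
    intro n
    rw [hhnr, tsum_sphere]
    exact Finset.sum_nbij' (·⁻¹) (·⁻¹) (by simp [len_inv]) (by simp [len_inv]) (by simp)
      (by simp) (by simp)
  have hproj : ∀ (m n : ℕ) (f : W L →₀ ℂ), f ∈ grade L l →
      Q (m + n + l) (hn m (hnr n (toH L f))) =
        toH L ((raise leftAct ^ m) ((raise rightAct ^ n) f)) := fun m n f hf =>
    proj_sphere_sum_sphere_sum (Sw := fun w => Twr w⁻¹) hA hB hT hTw1 hTwrec hhn' hTr' hTwr1'
      hTwrrec' hhnr' hQ hf m n
  rw [hproj m n f hf, hproj m' n' g hg]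
  obtain ⟨k, rfl⟩ : ∃ k, l = k + 1 := ⟨l - 1, by omega⟩
  refine inner_raise_raise hl hf hg ?_ ?_ m n m' n'
  · refine lower_eq_zero_of_orthogonal hA hT hQ hf fun y hy => ?_
    rw [← hh]
    exact hξperp _ (Submodule.subset_span (Or.inl ⟨y, hy, rfl⟩))
  · refine lower_eq_zero_of_orthogonal hB hTr' hQ hf fun y hy => ?_
    rw [← hRh]
    exact hξperp _ (Submodule.subset_span (Or.inr ⟨y, hy, rfl⟩))

end UCoxMasa
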